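/- Let U, k, l ∈ ℕ₊ with l ≥ 2 and M > 0. There exist a depth J ≤ (128+14U)lk/(s−1) + 3U + 61, a depth-J CNN h_J with input dimension lk, and integers n₁, n₂ ≥ 0 such that for all vectors y_1, …, y_l ∈ [0,M]^k one has h_J([y_1; y_2; y_3; …; y_l]) = [0_{n₁}; ×̃_{M,U}(y_1,y_2); y_3; …; y_l; 0_{n₂}], where ×̃_{M,U}(y_1,y_2) denotes the vector (×̃_{M,U}(y_{1,1},y_{2,1}), …, ×̃_{M,U}(y_{1,k},y_{2,k})). -/

import Mathlib

noncomputable section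

open Finset

/-- The ReLU function. -/
def relu (t : ℝ) : ℝ := max t 0

/-- Zero extension of a filter `w ∈ ℝ^{m+1}` to all of `ℕ` (`w_j := 0` for `j ∉ {0,…,m}`). -/
def filt {m : ℕ} (w : Fin (m + 1) → ℝ) : ℕ → ℝ :=
  fun j => if h : j < m + 1 then w ⟨j, h⟩ else 0

/-- Discrete convolution of a filter `w ∈ ℝ^{m+1}` with a vector `x ∈ ℝ^n`
(represented as `x : ℕ → ℝ`, entries of index `≥ n` being ignored), producing a vector
in `ℝ^{n+m}`: `(w*x)_i = ∑_{k<n} w_{i-k} x_k` (zero-based indexing). -/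
def conv {m : ℕ} (w : Fin (m + 1) → ℝ) (n : ℕ) (x : ℕ → ℝ) : ℕ → ℝ :=
  fun i => ∑ k ∈ Finset.range n, if k ≤ i then filt w (i - k) * x k else 0

/-- One CNN layer with filter `w ∈ ℝ^{s+1}` and bias `b`, acting on a vector of length `n`:
`x ↦ σ(w*x + b) ∈ ℝ^{n+s}` (entries of index `≥ n+s` are set to `0`). -/
def layer (s : ℕ) (w : Fin (s + 1) → ℝ) (b : ℕ → ℝ) (n : ℕ) (x : ℕ → ℝ) : ℕ → ℝ :=
  fun i => if i < n + s then relu (conv w n x i + b i) else 0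

/-- Apply a list of CNN layers (given by their filter/bias pairs) to a vector of length `n`;
a list of length `L` yields the depth-`L` CNN map `h_L = σ∘A_{w_L,b_L}∘⋯∘σ∘A_{w_1,b_1}`. -/
def applyCNN (s : ℕ) : List ((Fin (s + 1) → ℝ) × (ℕ → ℝ)) → ℕ → (ℕ → ℝ) → (ℕ → ℝ)
  | [], _, x => x
  | wb :: ps, n, x => applyCNN s ps (n + s) (layer s wb.1 wb.2 n x)

/-- A vector `x ∈ ℝ^n` viewed as an element of `ℕ → ℝ` (zero outside `{0,…,n-1}`). -/
def embed (n : ℕ) (x : Fin n → ℝ) : ℕ → ℝ := fun i => if h : i < n then x ⟨i, h⟩ else 0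

/-- The sawtooth function `T₁`. -/
def T1 (x : ℝ) : ℝ := if x ≤ 1 / 2 then 2 * x else 2 * (1 - x)

/-- `R_U(x) = x - ∑_{i=1}^U T_i(x)/4^i`, where `T_i = T₁∘⋯∘T₁` (`i` times). -/
def RU (U : ℕ) (x : ℝ) : ℝ := x - ∑ i ∈ Finset.Icc 1 U, T1^[i] x / 4 ^ i

/-- The approximate product `×̃_{M,U}`. -/
def aprod (M : ℝ) (U : ℕ) (x y : ℝ) : ℝ :=
  2 * M ^ 2 * (RU U ((x + y) / (2 * M)) - (1 / 4) * RU U (x / M) - (1 / 4) * RU U (y / M))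

/-- The convolution of a polynomial filter with a sequence. -/
def polyConv (P : Polynomial ℝ) (u : ℕ → ℝ) (q : ℕ) : ℝ :=
  PowerSeries.coeff q ((P : PowerSeries ℝ) * PowerSeries.mk u)

lemma polyConv_eq_sum (P : Polynomial ℝ) (u : ℕ → ℝ) (q : ℕ) :
    polyConv P u q = ∑ j ∈ range (q + 1), P.coeff j * u (q - j) := by
  rw [polyConv, PowerSeries.coeff_mul, Finset.Nat.sum_antidiagonal_eq_sum_range_succ_mk]
  simp

lemma polyConv_add_left (P Q : Polynomial ℝ) (u : ℕ → ℝ) (q : ℕ) :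
    polyConv (P + Q) u q = polyConv P u q + polyConv Q u q := by
  simp [polyConv, add_mul]

lemma polyConv_add_right (P : Polynomial ℝ) (u v : ℕ → ℝ) (q : ℕ) :
    polyConv P (fun i => u i + v i) q = polyConv P u q + polyConv P v q := by
  simp [polyConv_eq_sum, mul_add, Finset.sum_add_distrib]

lemma polyConv_mul (P Q : Polynomial ℝ) (u : ℕ → ℝ) (q : ℕ) :
    polyConv (P * Q) u q = polyConv P (polyConv Q u) q := by
  have h : PowerSeries.mk (polyConv Q u) = (Q : PowerSeries ℝ) * PowerSeries.mk u := by
    ext i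
    simp [polyConv]
  simp only [polyConv] at h ⊢
  rw [h, Polynomial.coe_mul, mul_assoc]

lemma polyConv_C_mul_X_pow (c : ℝ) (d : ℕ) (u : ℕ → ℝ) (q : ℕ) :
    polyConv (Polynomial.C c * Polynomial.X ^ d) u q = if d ≤ q then c * u (q - d) else 0 := by
  simp only [polyConv, Polynomial.coe_mul, Polynomial.coe_C, Polynomial.coe_pow,
    Polynomial.coe_X, mul_assoc]
  rw [PowerSeries.coeff_C_mul, PowerSeries.coeff_X_pow_mul']
  split_ifs <;> simp

lemma polyConv_X_pow (d : ℕ) (u : ℕ → ℝ) (q : ℕ) :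
    polyConv (Polynomial.X ^ d) u q = if d ≤ q then u (q - d) else 0 := by
  simpa using polyConv_C_mul_X_pow 1 d u q

lemma polyConv_C (c : ℝ) (u : ℕ → ℝ) (q : ℕ) : polyConv (Polynomial.C c) u q = c * u q := by
  simpa using polyConv_C_mul_X_pow c 0 u q

lemma polyConv_one (u : ℕ → ℝ) (q : ℕ) : polyConv 1 u q = u q := by
  simpa using polyConv_C 1 u q

lemma abs_polyConv_le (P : Polynomial ℝ) {u : ℕ → ℝ} {B : ℝ} (hu : ∀ i, |u i| ≤ B) (q : ℕ) :
    |polyConv P u q| ≤ (∑ j ∈ P.support, |P.coeff j|) * B := by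
  have hB : 0 ≤ B := (abs_nonneg _).trans (hu 0)
  calc |polyConv P u q| ≤ ∑ j ∈ range (q + 1), |P.coeff j| * B := by
        rw [polyConv_eq_sum]
        refine (Finset.abs_sum_le_sum_abs _ _).trans (Finset.sum_le_sum fun j _ => ?_)
        rw [abs_mul]
        exact mul_le_mul_of_nonneg_left (hu _) (abs_nonneg _)
    _ = (∑ j ∈ range (q + 1), |P.coeff j|) * B := by rw [Finset.sum_mul]
    _ ≤ (∑ j ∈ P.support, |P.coeff j|) * B := by
        refine mul_le_mul_of_nonneg_right ?_ hB
        rw [Finset.sum_subset (s₁ := P.support) (s₂ := range (q + 1) ∪ P.support)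
          Finset.subset_union_right fun j _ hj => by simpa using hj]
        exact Finset.sum_le_sum_of_subset_of_nonneg Finset.subset_union_left
          fun j _ _ => abs_nonneg _

lemma polyConv_eq_zero {P : Polynomial ℝ} {E m q : ℕ} {u : ℕ → ℝ} (hP : P.natDegree ≤ E)
    (hu : ∀ i, m ≤ i → u i = 0) (hq : m + E ≤ q) : polyConv P u q = 0 := by
  rw [polyConv_eq_sum]
  refine Finset.sum_eq_zero fun j _ => ?_
  rcases le_or_gt j E with h | h
  · rw [hu _ (by omega), mul_zero]
  · rw [Polynomial.coeff_eq_zero_of_natDegree_lt (by omega), zero_mul]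

/-- Convolving with a filter in `X ^ k` acts separately on each residue class modulo `k`. -/
lemma polyConv_expand {k : ℕ} (hk : 0 < k) (P : Polynomial ℝ) (v : ℕ → ℕ → ℝ) (i : ℕ) :
    polyConv (Polynomial.expand ℝ k P) (fun i => v (i / k) (i % k)) i =
      polyConv P (fun q => v q (i % k)) (i / k) := by
  induction P using Polynomial.induction_on' with
  | add P Q hP hQ => rw [map_add, polyConv_add_left, polyConv_add_left, hP, hQ]
  | monomial d c =>
    rw [Polynomial.expand_monomial, ← Polynomial.C_mul_X_pow_eq_monomial,
      ← Polynomial.C_mul_X_pow_eq_monomial, polyConv_C_mul_X_pow, polyConv_C_mul_X_pow]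
    have h : d * k ≤ i ↔ d ≤ i / k := (Nat.le_div_iff_mul_le hk).symm
    by_cases hd : d ≤ i / k
    · obtain ⟨r, rfl⟩ := Nat.exists_eq_add_of_le (h.2 hd)
      rw [if_pos (h.2 hd), if_pos hd, Nat.add_sub_cancel_left, Nat.mul_add_mod_self_right,
        add_comm (d * k), Nat.add_mul_div_right _ _ hk, Nat.add_sub_cancel]
    · rw [if_neg (mt h.1 hd), if_neg hd]

lemma conv_eq_polyConv {s n : ℕ} {Q : Polynomial ℝ} (hQ : Q.natDegree ≤ s) {x : ℕ → ℝ}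
    (hx : ∀ i, n ≤ i → x i = 0) (i : ℕ) :
    conv (fun j : Fin (s + 1) => Q.coeff j) n x i = polyConv Q x i := by
  have hf : ∀ j, filt (fun j : Fin (s + 1) => Q.coeff j) j = Q.coeff j := by
    intro j
    by_cases h : j < s + 1
    · simp [filt, h]
    · rw [Polynomial.coeff_eq_zero_of_natDegree_lt (by omega)]
      simp [filt, h]
  rw [polyConv_eq_sum, ← Finset.sum_range_reflect]
  simp only [conv, hf]
  trans ∑ k ∈ range (n + (i + 1)), if k ≤ i then Q.coeff (i - k) * x k else 0
  · refine Finset.sum_subset (by simp) fun k _ hk => ?_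
    rw [hx k (by simpa using hk)]
    simp
  · symm
    trans ∑ k ∈ range (i + 1), if k ≤ i then Q.coeff (i - k) * x k else 0
    · refine Finset.sum_congr rfl fun k hk => ?_
      rw [Finset.mem_range] at hk
      rw [if_pos (by omega)]
      congr 2; omega
    · refine Finset.sum_subset (by simp) fun k _ hk => ?_
      rw [Finset.mem_range] at hk
      rw [if_neg (by omega)]

/-- A convolution by a product of short filters, followed by an arbitrary bias, is computed on
bounded inputs by one layer per filter. -/
lemma exists_cnn_of_list {s : ℕ} (Q : Polynomial ℝ) (Qs : List (Polynomial ℝ))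
    (hQ : Q.natDegree ≤ s) (hQs : ∀ R ∈ Qs, R.natDegree ≤ s) (n : ℕ) (B : ℝ) (b : ℕ → ℝ) :
    ∃ ps : List ((Fin (s + 1) → ℝ) × (ℕ → ℝ)), ps.length = Qs.length + 1 ∧
      ∀ x : ℕ → ℝ, (∀ i, |x i| ≤ B) → (∀ i, n ≤ i → x i = 0) →
        applyCNN s ps n x = fun i =>
          if i < n + ps.length * s then relu (polyConv (Qs.prod * Q) x i + b i) else 0 := by
  induction Qs generalizing Q n B b with
  | nil =>
    refine ⟨[(fun j => Q.coeff j, b)], rfl, fun x _ hx => ?_⟩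
    ext i
    simp [applyCNN, layer, conv_eq_polyConv hQ hx]
  | cons R Qs ih =>
    set K : ℝ := (∑ j ∈ Q.support, |Q.coeff j|) * B
    set one : ℕ → ℝ := fun i => if i < n + s then K else 0 with hone
    obtain ⟨ps, hlen, hps⟩ := ih R (hQs R (by simp)) (fun S hS => hQs S (by simp [hS]))
      (n + s) (2 * |K|) (fun i => b i - polyConv (Qs.prod * R) one i)
    refine ⟨(fun j => Q.coeff j, fun _ => K) :: ps, by simp [hlen], fun x hxB hx => ?_⟩
    have hb : ∀ i, |polyConv Q x i| ≤ K := abs_polyConv_le Q hxB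
    have hl : layer s (fun j => Q.coeff j) (fun _ => K) n x =
        fun i => polyConv Q x i + one i := by
      ext i
      simp only [layer, conv_eq_polyConv hQ hx, hone]
      split_ifs with h
      · exact max_eq_left (by linarith [(abs_le.1 (hb i)).1])
      · rw [polyConv_eq_zero hQ hx (by omega), add_zero]
    have hKn : 0 ≤ K := (abs_nonneg _).trans (hb 0)
    rw [applyCNN, hl, hps]
    · ext i
      rw [polyConv_add_right, ← polyConv_mul, List.prod_cons, List.length_cons,
        show n + s + ps.length * s = n + (ps.length + 1) * s by ring,
        mul_comm R, add_assoc, add_sub_cancel]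
    · intro i
      refine (abs_add_le _ _).trans ?_
      have : |one i| ≤ |K| := by
        simp only [hone]
        split_ifs <;> simp
      have := hb i
      rw [abs_of_nonneg hKn] at *
      linarith
    · intro i hi
      simp only [hone]
      rw [polyConv_eq_zero hQ hx hi, if_neg (by omega), add_zero]

lemma exists_dvd_natDegree {P : Polynomial ℝ} {m : ℕ} (hm : m + 1 ≤ P.natDegree) :
    ∃ Q, Q ∣ P ∧ m + 1 ≤ Q.natDegree ∧ Q.natDegree ≤ m + 2 := by
  have key : ∀ R : Polynomial ℝ, 1 ≤ R.natDegree →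
      ∃ Q, Q ∣ R ∧ 1 ≤ Q.natDegree ∧ Q.natDegree ≤ 2 := by
    intro R hR
    obtain ⟨Q, hQ, hd⟩ := Polynomial.exists_irreducible_of_natDegree_pos (f := R) (by omega)
    exact ⟨Q, hd, hQ.natDegree_pos, hQ.natDegree_le_two⟩
  induction m with
  | zero => exact key P hm
  | succ m ih =>
    obtain ⟨Q, ⟨R, rfl⟩, h1, h2⟩ := ih (by omega)
    rcases eq_or_lt_of_le h2 with h | h
    · exact ⟨Q, dvd_mul_right _ _, by omega, by omega⟩
    · have h0 : Q * R ≠ 0 := by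
        rintro h0
        simp [h0] at hm
      rw [Polynomial.natDegree_mul (left_ne_zero_of_mul h0) (right_ne_zero_of_mul h0)] at hm
      obtain ⟨S, hS, h3, h4⟩ := key R (by omega)
      have hS0 : S ≠ 0 := by
        rintro rfl
        simp at h3
      refine ⟨Q * S, mul_dvd_mul_left Q hS, ?_⟩
      rw [Polynomial.natDegree_mul (left_ne_zero_of_mul h0) hS0]
      omega

/-- Factorization of a long filter into short ones. -/
lemma exists_factorization {s : ℕ} (hs : 2 ≤ s) (E : ℕ) (P : Polynomial ℝ)
    (hP : P.natDegree ≤ E) :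
    ∃ (Q : Polynomial ℝ) (Qs : List (Polynomial ℝ)), Q.natDegree ≤ s ∧
      (∀ R ∈ Qs, R.natDegree ≤ s) ∧ Qs.prod * Q = P ∧ E ≤ (Qs.length + 1) * s ∧
      Qs.length * (s - 1) ≤ E := by
  induction E using Nat.strong_induction_on generalizing P with
  | _ E ih =>
    rcases le_or_gt E s with h | h
    · exact ⟨P, [], by omega, by simp, by simp, by simpa using h, by simp⟩
    · obtain ⟨R, T, hRT, hR, hT⟩ : ∃ R T : Polynomial ℝ, R * T = P ∧ R.natDegree ≤ s ∧
          T.natDegree ≤ E - (s - 1) := by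
        rcases le_or_gt P.natDegree s with hd | hd
        · exact ⟨P, 1, mul_one P, hd, by simp⟩
        · obtain ⟨R, ⟨T, rfl⟩, h1, h2⟩ := exists_dvd_natDegree (P := P) (m := s - 2) (by omega)
          refine ⟨R, T, rfl, by omega, ?_⟩
          have h0 : R * T ≠ 0 := by
            rintro h0
            simp only [h0, Polynomial.natDegree_zero] at hd
            omega
          rw [Polynomial.natDegree_mul (left_ne_zero_of_mul h0) (right_ne_zero_of_mul h0)] at hP
          omega
      obtain ⟨Q, Qs, h1, h2, h3, h4, h5⟩ := ih (E - (s - 1)) (by omega) T hT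
      refine ⟨Q, R :: Qs, h1, ?_, ?_, ?_, ?_⟩
      · simpa using ⟨hR, h2⟩
      · rw [List.prod_cons, mul_assoc, h3, hRT]
      · rw [List.length_cons, add_mul, one_mul]
        omega
      · rw [List.length_cons, add_mul, one_mul]
        omega

/-- `Implements s k l M D c m F`: a CNN with at most `D * k / (s - 1) + c` layers maps the
concatenation of `l` vectors of length `k` to the sequence whose `q`-th block of length `k` has
`j`-th entry `F u q`, where `u` lists the `j`-th entries of the input vectors and takes values in
`[0, M]`. Moreover `F u` is uniformly bounded and vanishes from `m` on. -/
def Implements (s k l : ℕ) (M : ℝ) (D c m : ℕ) (F : (ℕ → ℝ) → ℕ → ℝ) : Prop :=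
  (∃ B, ∀ u, (∀ a, u a ∈ Set.Icc 0 M) → ∀ q, |F u q| ≤ B) ∧
  (∀ u, (∀ a, u a ∈ Set.Icc 0 M) → ∀ q, m ≤ q → F u q = 0) ∧
  ∃ ps : List ((Fin (s + 1) → ℝ) × (ℕ → ℝ)),
    (ps.length : ℝ) ≤ D * k / ((s : ℝ) - 1) + c ∧
    m * k ≤ l * k + ps.length * s ∧
    ∀ Y : ℕ → ℕ → ℝ, (∀ a b, Y a b ∈ Set.Icc 0 M) →
      applyCNN s ps (l * k) (fun i => if i < l * k then Y (i / k) (i % k) else 0) =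
        fun i => F (fun a => Y a (i % k)) (i / k)

lemma applyCNN_append (s : ℕ) (ps qs : List ((Fin (s + 1) → ℝ) × (ℕ → ℝ))) (n : ℕ)
    (x : ℕ → ℝ) :
    applyCNN s (ps ++ qs) n x = applyCNN s qs (n + ps.length * s) (applyCNN s ps n x) := by
  induction ps generalizing n x with
  | nil => simp [applyCNN]
  | cons p ps ih =>
    rw [List.cons_append, applyCNN, ih, applyCNN, List.length_cons,
      show n + s + ps.length * s = n + (ps.length + 1) * s by ring]

lemma Implements.congr {s k l : ℕ} {M : ℝ} {D c m : ℕ} {F G : (ℕ → ℝ) → ℕ → ℝ}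
    (hF : Implements s k l M D c m F)
    (h : ∀ u, (∀ a, u a ∈ Set.Icc 0 M) → F u = G u) : Implements s k l M D c m G := by
  obtain ⟨⟨B, hB⟩, h0, ps, h1, h2, h3⟩ := hF
  refine ⟨⟨B, fun u hu => h u hu ▸ hB u hu⟩, fun u hu => h u hu ▸ h0 u hu, ps, h1, h2,
    fun Y hY => ?_⟩
  rw [h3 Y hY]
  ext i
  rw [h _ fun a => hY a _]

lemma implements_input {s k l : ℕ} {M : ℝ} (hk : 0 < k) :
    Implements s k l M 0 0 l (fun u q => if q < l then u q else 0) := by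
  refine ⟨⟨|M|, fun u hu q => ?_⟩, fun u _ q hq => if_neg (by omega), [], by simp, by simp,
    fun Y _ => ?_⟩
  · dsimp only
    split_ifs
    · rw [abs_of_nonneg (hu q).1]
      exact (hu q).2.trans (le_abs_self M)
    · simp
  · ext i
    simp [applyCNN, Nat.div_lt_iff_lt_mul hk]

open Classical in
/-- One convolution with an arbitrary long filter followed by an arbitrary bias, where moreover
all blocks outside of `S` are reset to zero. -/
lemma Implements.step {s k l : ℕ} {M : ℝ} {D c m : ℕ} {F : (ℕ → ℝ) → ℕ → ℝ} (hs : 2 ≤ s)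
    (hk : 0 < k) (hF : Implements s k l M D c m F) (E : ℕ) (P : Polynomial ℝ)
    (hP : P.natDegree ≤ E) (b : ℕ → ℝ) (S : Set ℕ) (hS : ∀ q ∈ S, q < m + E) :
    Implements s k l M (D + E) (c + 1) (m + E)
      (fun u q => if q ∈ S then relu (polyConv P (F u) q + b q) else 0) := by
  obtain ⟨⟨B, hB⟩, h0, ps, h1, h2, h3⟩ := hF
  set K : ℝ := (∑ j ∈ P.support, |P.coeff j|) * B
  have hKP : ∀ u, (∀ a, u a ∈ Set.Icc 0 M) → ∀ q, |polyConv P (F u) q| ≤ K :=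
    fun u hu => abs_polyConv_le P (hB u hu)
  refine ⟨⟨|K| + ∑ q ∈ range (m + E), |b q|, fun u hu q => ?_⟩, fun u _ q hq => ?_, ?_⟩
  · have hsum : 0 ≤ ∑ q ∈ range (m + E), |b q| := Finset.sum_nonneg fun _ _ => abs_nonneg _
    dsimp only
    split_ifs with hq
    · have h4 : |b q| ≤ ∑ q ∈ range (m + E), |b q| :=
        Finset.single_le_sum (f := fun q => |b q|) (fun _ _ => abs_nonneg _)
          (Finset.mem_range.2 (hS q hq))
      have h5 := hKP u hu q
      rw [relu, abs_of_nonneg (le_max_right _ _)]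
      refine max_le ?_ (by positivity)
      linarith [le_abs_self (b q), le_abs_self K, le_abs_self (polyConv P (F u) q)]
    · rw [abs_zero]
      positivity
  · exact if_neg fun h => by have := hS q h; omega
  · obtain ⟨Q, Qs, hQ, hQs, hprod, hE1, hE2⟩ := exists_factorization hs (E * k)
      (Polynomial.expand ℝ k P) (by
        rw [Polynomial.natDegree_expand]
        exact Nat.mul_le_mul_right k hP)
    obtain ⟨qs, hlen, hqs⟩ := exists_cnn_of_list Q Qs hQ hQs (l * k + ps.length * s) B
      (fun i => if i / k ∈ S then b (i / k) else -K)
    refine ⟨ps ++ qs, ?_, ?_, fun Y hY => ?_⟩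
    · have hs1 : (0 : ℝ) < (s : ℝ) - 1 := by
        have : (2 : ℝ) ≤ s := by exact_mod_cast hs
        linarith
      have h4 : (Qs.length : ℝ) ≤ E * k / ((s : ℝ) - 1) := by
        rw [le_div_iff₀ hs1]
        have : ((Qs.length * (s - 1) : ℕ) : ℝ) ≤ ((E * k : ℕ) : ℝ) := by exact_mod_cast hE2
        rw [Nat.cast_mul, Nat.cast_sub (by omega)] at this
        simpa using this
      rw [List.length_append, hlen]
      push_cast
      rw [add_mul, add_div]
      linarith
    · rw [List.length_append, hlen, add_mul, add_mul]
      omega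
    · rw [applyCNN_append, h3 Y hY, hqs _ (fun i => hB _ (fun a => hY a _) _)]
      · ext i
        dsimp only
        rw [hprod, polyConv_expand hk P (fun q j => F (fun a => Y a j) q)]
        have h5 := abs_le.1 (hKP (fun a => Y a (i % k)) (fun a => hY a _) (i / k))
        by_cases hi : i / k ∈ S
        · have h6 : i < (m + E) * k := (Nat.div_lt_iff_lt_mul hk).1 (hS _ hi)
          rw [add_mul] at h6
          rw [if_pos hi, if_pos hi, if_pos (by rw [hlen]; omega)]
        · rw [if_neg hi, if_neg hi]
          split_ifs
          · exact max_eq_right (by linarith [h5.2])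
          · rfl
      · intro i hi
        refine h0 _ (fun a => hY a _) _ ?_
        rw [Nat.le_div_iff_mul_le hk]
        omega

lemma T1_mem {x : ℝ} (hx : x ∈ Set.Icc (0 : ℝ) 1) : T1 x ∈ Set.Icc (0 : ℝ) 1 := by
  obtain ⟨h0, h1⟩ := hx
  unfold T1
  split_ifs <;> constructor <;> linarith

lemma T1_iterate_mem {x : ℝ} (hx : x ∈ Set.Icc (0 : ℝ) 1) (i : ℕ) :
    T1^[i] x ∈ Set.Icc (0 : ℝ) 1 := by
  induction i with
  | zero => exact hx
  | succ i ih =>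
    rw [Function.iterate_succ_apply']
    exact T1_mem ih

lemma T1_one_sub (x : ℝ) : T1 (1 - x) = T1 x := by
  unfold T1
  split_ifs <;> linarith

lemma RU_zero (x : ℝ) : RU 0 x = x := by simp [RU]

lemma RU_succ (U : ℕ) (x : ℝ) : RU (U + 1) x = RU U x - T1^[U + 1] x / 4 ^ (U + 1) := by
  rw [RU, RU, Finset.sum_Icc_succ_top (by omega)]
  ring

lemma RU_succ' (U : ℕ) (x : ℝ) : RU (U + 1) x = x - T1 x / 2 + RU U (T1 x) / 4 := by
  induction U with
  | zero =>
    rw [RU_succ, RU_zero, RU_zero]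
    simp
    ring
  | succ U ih =>
    rw [RU_succ, ih, RU_succ U (T1 x), Function.iterate_succ_apply]
    ring

lemma RU_succ_le {x : ℝ} (hx : x ∈ Set.Icc (0 : ℝ) 1) (U : ℕ) : RU (U + 1) x ≤ RU U x := by
  rw [RU_succ]
  have := (T1_iterate_mem hx (U + 1)).1
  have : 0 ≤ T1^[U + 1] x / 4 ^ (U + 1) := by positivity
  linarith

lemma RU_one_sub (U : ℕ) (x : ℝ) : RU U (1 - x) = RU U x + 1 - 2 * x := by
  cases U with
  | zero =>
    rw [RU_zero, RU_zero]
    ring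
  | succ U =>
    rw [RU_succ', RU_succ', T1_one_sub]
    ring

lemma Implements.step_to {s k l : ℕ} {M : ℝ} {D c m : ℕ} {F G : (ℕ → ℝ) → ℕ → ℝ} (hs : 2 ≤ s)
    (hk : 0 < k) (hF : Implements s k l M D c m F) (E : ℕ) (P : Polynomial ℝ)
    (hP : P.natDegree ≤ E) (b : ℕ → ℝ) (S : Set ℕ) (hS : ∀ q ∈ S, q < m + E)
    (hG : ∀ u, (∀ a, u a ∈ Set.Icc 0 M) → ∀ q,
      (q ∈ S → max (polyConv P (F u) q + b q) 0 = G u q) ∧ (q ∉ S → G u q = 0)) :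
    Implements s k l M (D + E) (c + 1) (m + E) G := by
  classical
  refine (hF.step hs hk E P hP b S hS).congr fun u hu => ?_
  ext q
  by_cases hq : q ∈ S
  · simp only [if_pos hq]
    exact (hG u hu q).1 hq
  · simp only [if_neg hq]
    exact ((hG u hu q).2 hq).symm

/-- A state of the network at offset `β`: two registers `tb`, `tc`, the entries
`p 2, …, p (l - 1)` that have to be transported, a third register `ta` and an accumulator. -/
def tape (β l : ℕ) (p : ℕ → ℝ) (tb tc ta acc : ℝ) (q : ℕ) : ℝ :=
  if q = β then tb
  else if q = β + 1 then tc
  else if β + 2 ≤ q ∧ q < β + l then p (q - β)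
  else if q = β + l + 1 then ta
  else if q = β + 2 * l + 3 then acc
  else 0

section tape

variable {β l : ℕ} {p : ℕ → ℝ} {tb tc ta acc : ℝ} {q : ℕ}

lemma tape_b (h : q = β) : tape β l p tb tc ta acc q = tb := if_pos h

lemma tape_c (h : q = β + 1) : tape β l p tb tc ta acc q = tc := by
  simp (disch := omega) only [tape, if_pos, if_neg]

lemma tape_p (h : β + 2 ≤ q ∧ q < β + l) : tape β l p tb tc ta acc q = p (q - β) := by
  simp (disch := omega) only [tape, if_pos, if_neg]

lemma tape_a (hl : 2 ≤ l) (h : q = β + l + 1) : tape β l p tb tc ta acc q = ta := by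
  simp (disch := omega) only [tape, if_pos, if_neg]

lemma tape_acc (h : q = β + 2 * l + 3) : tape β l p tb tc ta acc q = acc := by
  simp (disch := omega) only [tape, if_pos, if_neg]

lemma tape_zero (hl : 2 ≤ l) (h : q < β ∨ q = β + l ∨ (β + l + 1 < q ∧ q < β + 2 * l + 3) ∨
    β + 2 * l + 3 < q) : tape β l p tb tc ta acc q = 0 := by
  simp (disch := omega) only [tape, if_neg]

lemma tape_nonneg (hp : ∀ q, 0 ≤ p q) (hb : 0 ≤ tb) (hc : 0 ≤ tc) (ha : 0 ≤ ta)
    (hacc : 0 ≤ acc) (q : ℕ) : 0 ≤ tape β l p tb tc ta acc q := by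
  unfold tape
  split_ifs <;> first | assumption | exact hp _ | exact le_rfl

end tape

lemma implements_init {s k l : ℕ} {M : ℝ} (hs : 2 ≤ s) (hk : 0 < k) (hl : 2 ≤ l) (hM : 0 < M) :
    Implements s k l M (2 * l + 3) 1 (3 * l + 3)
      (fun u => tape 0 l u (u 0) (u 1) (u 0 + u 1) (M / 2 * (u 0 + u 1))) := by
  have := (implements_input (s := s) (l := l) (M := M) hk).step_to hs hk (2 * l + 3)
    (1 + Polynomial.X ^ l + Polynomial.X ^ (l + 1) +
      Polynomial.C (M / 2) * Polynomial.X ^ (2 * l + 2) +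
      Polynomial.C (M / 2) * Polynomial.X ^ (2 * l + 3))
    (by compute_degree; omega) (fun _ => 0)
    {q | q < l ∨ q = l + 1 ∨ q = 2 * l + 3} (by
      rintro q (h | h | h) <;> omega)
    (G := fun u => tape 0 l u (u 0) (u 1) (u 0 + u 1) (M / 2 * (u 0 + u 1))) (by
      intro u hu q
      have h0 := (hu 0).1
      have h1 := (hu 1).1
      have h2 := (hu q).1
      simp only [Set.mem_ofPred_eq, polyConv_add_left, polyConv_one, polyConv_X_pow,
        polyConv_C_mul_X_pow]
      have h3 : 0 ≤ M / 2 * (u 0 + u 1) := by positivity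
      refine ⟨?_, ?_⟩
      · rintro (h | rfl | rfl)
        · have : tape 0 l u (u 0) (u 1) (u 0 + u 1) (M / 2 * (u 0 + u 1)) q = u q := by
            grind [tape]
          rw [this]
          simp (disch := omega) only [if_pos, if_neg, add_zero, max_eq_left h2]
        · have : tape 0 l u (u 0) (u 1) (u 0 + u 1) (M / 2 * (u 0 + u 1)) (l + 1) = u 0 + u 1 := by
            grind [tape]
          rw [this]
          grind
        · have : tape 0 l u (u 0) (u 1) (u 0 + u 1) (M / 2 * (u 0 + u 1)) (2 * l + 3) =
            M / 2 * (u 0 + u 1) := by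
            grind [tape]
          rw [this]
          grind
      · grind [tape])
  convert this using 1 <;> omega

lemma Implements.iterate {s k l : ℕ} {M : ℝ} {D c m β : ℕ} {p : (ℕ → ℝ) → ℕ → ℝ}
    {tb tc ta acc tb' tc' ta' acc' : (ℕ → ℝ) → ℝ} (hs : 2 ≤ s) (hk : 0 < k) (hl : 2 ≤ l)
    (hF : Implements s k l M D c m fun u => tape β l (p u) (tb u) (tc u) (ta u) (acc u))
    (hm : β + 2 * l + 3 < m) (μ ν κ ρ : ℝ)
    (hp : ∀ u, (∀ a, u a ∈ Set.Icc 0 M) → ∀ q, 0 ≤ p u q)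
    (h0 : ∀ u, (∀ a, u a ∈ Set.Icc 0 M) → 0 ≤ tb u ∧ 0 ≤ tc u ∧ 0 ≤ ta u ∧ 0 ≤ acc u)
    (h0' : ∀ u, (∀ a, u a ∈ Set.Icc 0 M) → 0 ≤ tb' u ∧ 0 ≤ tc' u ∧ 0 ≤ ta' u ∧ 0 ≤ acc' u)
    (hb : ∀ u, (∀ a, u a ∈ Set.Icc 0 M) → tb' u = tb u - 2 * max (tb u - μ) 0)
    (hc : ∀ u, (∀ a, u a ∈ Set.Icc 0 M) → tc' u = tc u - 2 * max (tc u - μ) 0)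
    (ha : ∀ u, (∀ a, u a ∈ Set.Icc 0 M) → ta' u = ta u - 2 * max (ta u - ν) 0)
    (hacc : ∀ u, (∀ a, u a ∈ Set.Icc 0 M) →
      acc' u = acc u + κ * ta' u + ρ * (tb' u + tc' u)) :
    Implements s k l M (D + (6 * l + 11)) (c + 3) (m + (6 * l + 11))
      (fun u => tape (β + (2 * l + 4)) l (p u) (tb' u) (tc' u) (ta' u) (acc' u)) := by
  obtain ⟨d, hd⟩ : ∃ d, d = 2 * l + 4 := ⟨_, rfl⟩
  rw [← hd]
  have step1 := hF.step_to hs hk d (1 + Polynomial.X ^ d) (by compute_degree)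
    (fun q => if q = β + d ∨ q = β + d + 1 then -μ else if q = β + d + l + 1 then -ν else 0)
    {q | q < β + d ∨ q = β + d ∨ q = β + d + 1 ∨ q = β + d + l + 1} (by
      rintro q (h | h | h | h) <;> omega)
    (G := fun u q => tape β l (p u) (tb u) (tc u) (ta u) (acc u) q +
      tape (β + d) l (fun _ => 0) (max (tb u - μ) 0) (max (tc u - μ) 0) (max (ta u - ν) 0) 0 q) (by
      intro u hu q
      obtain ⟨h1, h2, h3, h4⟩ := h0 u hu
      have h5 := hp u hu
      simp only [Set.mem_ofPred_eq, polyConv_add_left, polyConv_one, polyConv_X_pow]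
      refine ⟨?_, ?_⟩
      · rintro (h | h | h | h)
        · have e : (if d ≤ q then tape β l (p u) (tb u) (tc u) (ta u) (acc u) (q - d) else 0) =
              0 := by
            split_ifs
            · exact tape_zero hl (by omega)
            · rfl
          rw [e, tape_zero (β := β + d) hl (by omega)]
          simp (disch := omega) only [if_neg, add_zero]
          exact max_eq_left (tape_nonneg h5 h1 h2 h3 h4 q)
        · simp (disch := omega) only [tape_zero, tape_b, if_pos, zero_add, sub_eq_add_neg]
        · simp (disch := omega) only [tape_zero, tape_c, if_pos, zero_add, sub_eq_add_neg]
        · simp (disch := omega) only [tape_zero, tape_a, if_pos, if_neg, zero_add,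
            sub_eq_add_neg]
      · intro h
        rw [tape_zero (β := β) hl (by omega), zero_add]
        rcases (by omega : (β + d + 2 ≤ q ∧ q < β + d + l) ∨ q = β + d + 2 * l + 3 ∨
          q = β + d + l ∨ (β + d + l + 1 < q ∧ q < β + d + 2 * l + 3) ∨ β + d + 2 * l + 3 < q)
          with h | h | h
        · exact tape_p h
        · exact tape_acc h
        · exact tape_zero hl (.inr h))
  have step2 := step1.step_to hs hk d (Polynomial.C (-2) + Polynomial.X ^ d)
    (by compute_degree) (fun q => 0) {q | β + d ≤ q ∧ q < β + 2 * d} (by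
      rintro q ⟨h, h'⟩
      omega)
    (G := fun u => tape (β + d) l (p u) (tb' u) (tc' u) (ta' u) (acc u)) (by
      intro u hu q
      obtain ⟨h1, h2, h3, h4⟩ := h0 u hu
      obtain ⟨h1', h2', h3', h4'⟩ := h0' u hu
      have h5 := hp u hu
      have h6 := hb u hu
      have h7 := hc u hu
      have h8 := ha u hu
      simp only [Set.mem_ofPred_eq, polyConv_add_left, polyConv_C, polyConv_X_pow]
      refine ⟨?_, ?_⟩
      · rintro ⟨h, h'⟩
        rw [if_pos (by omega), tape_zero (β := β) (q := q) hl (by omega), zero_add, add_zero]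
        rcases (by omega : q = β + d ∨ q = β + d + 1 ∨ (β + d + 2 ≤ q ∧ q < β + d + l) ∨
          q = β + d + l + 1 ∨ q = β + d + 2 * l + 3 ∨ (q = β + d + l ∨
          (β + d + l + 1 < q ∧ q < β + d + 2 * l + 3))) with h | h | h | h | h | h
        · simp (disch := omega) only [tape_b, tape_zero]
          rw [max_eq_left] <;> linarith
        · simp (disch := omega) only [tape_c, tape_zero]
          rw [max_eq_left] <;> linarith
        · simp (disch := omega) only [tape_p, tape_zero]
          rw [show q - d - β = q - (β + d) by omega, mul_zero, zero_add, add_zero,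
            max_eq_left (h5 _)]
        · simp (disch := omega) only [tape_a, tape_zero]
          rw [max_eq_left] <;> linarith
        · simp (disch := omega) only [tape_acc, tape_zero]
          rw [max_eq_left] <;> linarith
        · simp (disch := omega) only [tape_zero]
          simp
      · intro h
        exact tape_zero hl (by omega))
  have step3 := step2.step_to hs hk (2 * l + 3)
    (1 + Polynomial.C κ * Polynomial.X ^ (l + 2) + Polynomial.C ρ * Polynomial.X ^ (2 * l + 2) +
      Polynomial.C ρ * Polynomial.X ^ (2 * l + 3)) (by compute_degree; omega) (fun q => 0)
    {q | β + d ≤ q ∧ q < β + d + l ∨ q = β + d + l + 1 ∨ q = β + d + 2 * l + 3} (by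
      rintro q (h | h | h) <;> omega)
    (G := fun u => tape (β + d) l (p u) (tb' u) (tc' u) (ta' u) (acc' u)) (by
      intro u hu q
      obtain ⟨h1', h2', h3', h4'⟩ := h0' u hu
      have h5 := hp u hu
      have h6 := hacc u hu
      simp only [Set.mem_ofPred_eq, polyConv_add_left, polyConv_one, polyConv_C_mul_X_pow]
      refine ⟨?_, ?_⟩
      · rintro (h | h | h)
        · have e : ∀ n, l ≤ n → ∀ c : ℝ, (if n ≤ q then c *
              tape (β + d) l (p u) (tb' u) (tc' u) (ta' u) (acc u) (q - n) else 0) = 0 := by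
            intro n hn c
            split_ifs
            · rw [tape_zero hl (by omega), mul_zero]
            · rfl
          rw [e _ (by omega), e _ (by omega), e _ (by omega)]
          simp only [add_zero]
          rw [max_eq_left (tape_nonneg h5 h1' h2' h3' (h0 u hu).2.2.2 q)]
          simp (disch := omega) only [tape, if_neg]
        · have e : ∀ n, l + 2 ≤ n → ∀ c : ℝ, (if n ≤ q then c *
              tape (β + d) l (p u) (tb' u) (tc' u) (ta' u) (acc u) (q - n) else 0) = 0 := by
            intro n hn c
            split_ifs
            · rw [tape_zero hl (by omega), mul_zero]
            · rfl
          rw [e _ (by omega), e _ (by omega), e _ (by omega)]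
          simp (disch := omega) only [tape_a, add_zero, max_eq_left h3']
        · simp (disch := omega) only [tape_acc, tape_a, tape_b, tape_c, if_pos]
          rw [max_eq_left] <;> linarith
      · intro h
        exact tape_zero hl (by omega))
  convert step3 using 1 <;> omega

lemma RU_succ_of_le_half {x : ℝ} (hx : x ≤ 1 / 2) (U : ℕ) : RU (U + 1) x = RU U (2 * x) / 4 := by
  rw [RU_succ', T1, if_pos hx]
  ring

lemma RU_succ_of_half_le {x : ℝ} (hx : 1 / 2 ≤ x) (U : ℕ) :
    RU (U + 1) x = x - 1 / 4 + RU U (2 * x - 1) / 4 := by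
  have h : T1 x = 1 - (2 * x - 1) := by
    unfold T1
    split_ifs <;> linarith
  rw [RU_succ', h, RU_one_sub]
  ring

lemma RU_add_le_of_superadditive {U : ℕ}
    (h : ∀ a b : ℝ, 0 ≤ a → 0 ≤ b → a + b ≤ 1 → RU U a + RU U b ≤ RU U (a + b)) {a b : ℝ}
    (ha : a ≤ 1) (hb : b ≤ 1) (hab : 1 ≤ a + b) : RU U a + RU U b ≤ 1 + RU U (a + b - 1) := by
  have h1 := h (1 - a) (1 - b) (by linarith) (by linarith) (by linarith)
  have h2 := RU_one_sub U (1 - a + (1 - b))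
  rw [RU_one_sub, RU_one_sub] at h1
  rw [show 1 - (1 - a + (1 - b)) = a + b - 1 by ring] at h2
  linarith

lemma RU_superadditive (U : ℕ) (a b : ℝ) (ha : 0 ≤ a) (hb : 0 ≤ b) (hab : a + b ≤ 1) :
    RU U a + RU U b ≤ RU U (a + b) := by
  induction U generalizing a b with
  | zero => simp [RU_zero]
  | succ U ih =>
    have upper : ∀ a b : ℝ, 1 / 2 ≤ a → 0 ≤ b → a + b ≤ 1 →
        RU (U + 1) a + RU (U + 1) b ≤ RU (U + 1) (a + b) := by
      intro a b ha hb hab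
      rw [RU_succ_of_half_le ha, RU_succ_of_le_half (by linarith : b ≤ 1 / 2),
        RU_succ_of_half_le (by linarith : 1 / 2 ≤ a + b)]
      have := ih (2 * a - 1) (2 * b) (by linarith) (by linarith) (by linarith)
      rw [show 2 * a - 1 + 2 * b = 2 * (a + b) - 1 by ring] at this
      linarith
    rcases le_total (1 / 2) a with h1 | h1
    · exact upper a b h1 hb hab
    rcases le_total (1 / 2) b with h2 | h2
    · rw [add_comm, add_comm a]
      exact upper b a h2 ha (by linarith)
    rw [RU_succ_of_le_half h1, RU_succ_of_le_half h2]
    rcases le_total (1 / 2) (a + b) with h3 | h3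
    · rw [RU_succ_of_half_le h3]
      have := RU_add_le_of_superadditive (U := U) ih (a := 2 * a) (b := 2 * b) (by linarith)
        (by linarith) (by linarith)
      rw [show 2 * a + 2 * b = 2 * (a + b) by ring] at this
      linarith
    · rw [RU_succ_of_le_half h3]
      have := ih (2 * a) (2 * b) (by linarith) (by linarith) (by linarith)
      rw [show 2 * a + 2 * b = 2 * (a + b) by ring] at this
      linarith

lemma RU_add_le_four_mul_midpoint (U : ℕ) {a b : ℝ} (ha : a ∈ Set.Icc (0 : ℝ) 1)
    (hb : b ∈ Set.Icc (0 : ℝ) 1) : RU U a + RU U b ≤ 4 * RU U ((a + b) / 2) := by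
  obtain ⟨ha0, ha1⟩ := ha
  obtain ⟨hb0, hb1⟩ := hb
  cases U with
  | zero =>
    simp only [RU_zero]
    linarith
  | succ U =>
    rcases le_total (a + b) 1 with h | h
    · rw [RU_succ_of_le_half (by linarith : (a + b) / 2 ≤ 1 / 2),
        show 2 * ((a + b) / 2) = a + b by ring]
      have h1 := RU_superadditive (U + 1) a b ha0 hb0 h
      have h2 := RU_succ_le (x := a + b) ⟨by linarith, h⟩ U
      linarith
    · rw [RU_succ_of_half_le (by linarith : 1 / 2 ≤ (a + b) / 2),
        show 2 * ((a + b) / 2) - 1 = a + b - 1 by ring]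
      have h1 := RU_add_le_of_superadditive (RU_superadditive (U + 1)) ha1 hb1 h
      have h2 := RU_succ_le (x := a + b - 1) ⟨by linarith, by linarith⟩ U
      linarith

lemma div_mem_unit {M x : ℝ} (hM : 0 < M) (hx : x ∈ Set.Icc 0 M) :
    x / M ∈ Set.Icc (0 : ℝ) 1 :=
  ⟨div_nonneg hx.1 hM.le, (div_le_one hM).2 hx.2⟩

lemma add_div_mem_unit {M x y : ℝ} (hM : 0 < M) (hx : x ∈ Set.Icc 0 M)
    (hy : y ∈ Set.Icc 0 M) : (x + y) / (2 * M) ∈ Set.Icc (0 : ℝ) 1 :=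
  div_mem_unit (by positivity) ⟨add_nonneg hx.1 hy.1, by linarith [hx.2, hy.2]⟩

lemma aprod_nonneg {M x y : ℝ} (hM : 0 < M) (U : ℕ) (hx : x ∈ Set.Icc 0 M)
    (hy : y ∈ Set.Icc 0 M) : 0 ≤ aprod M U x y := by
  have h := RU_add_le_four_mul_midpoint U (div_mem_unit hM hx) (div_mem_unit hM hy)
  rw [show (x / M + y / M) / 2 = (x + y) / (2 * M) by field_simp] at h
  exact mul_nonneg (by positivity) (by linarith)

lemma aprod_zero {M : ℝ} (hM : M ≠ 0) (x y : ℝ) : aprod M 0 x y = M / 2 * (x + y) := by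
  simp only [aprod, RU_zero]
  field_simp
  ring

lemma aprod_succ (M : ℝ) (U : ℕ) (x y : ℝ) :
    aprod M (U + 1) x y = aprod M U x y +
      -(M / 2 ^ (U + 1)) * (2 * M / 2 ^ (U + 1) * T1^[U + 1] ((x + y) / (2 * M))) +
      M / (4 * 2 ^ (U + 1)) * 2 * (M / 2 ^ (U + 1) * T1^[U + 1] (x / M) +
        M / 2 ^ (U + 1) * T1^[U + 1] (y / M)) := by
  have h : (4 : ℝ) ^ (U + 1) = 2 ^ (U + 1) * 2 ^ (U + 1) := by
    rw [← mul_pow]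
    norm_num
  simp only [aprod, RU_succ, h]
  field_simp
  ring

/-- One application of the sawtooth function to a register holding `a * t`. -/
lemma half_mul_T1 {a : ℝ} (ha : 0 < a) (t : ℝ) :
    a / 2 * T1 t = a * t - 2 * max (a * t - a / 2) 0 := by
  unfold T1
  split_ifs with h
  · rw [max_eq_right (by nlinarith)]
    ring
  · rw [max_eq_left (by nlinarith)]
    ring

lemma implements_registers {s k l : ℕ} {M : ℝ} (hs : 2 ≤ s) (hk : 0 < k) (hl : 2 ≤ l)
    (hM : 0 < M) (i : ℕ) :
    Implements s k l M (2 * l + 3 + i * (6 * l + 11)) (1 + i * 3) (3 * l + 3 + i * (6 * l + 11))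
      (fun u => tape (i * (2 * l + 4)) l u (M / 2 ^ i * T1^[i] (u 0 / M))
        (M / 2 ^ i * T1^[i] (u 1 / M)) (2 * M / 2 ^ i * T1^[i] ((u 0 + u 1) / (2 * M)))
        (aprod M i (u 0) (u 1))) := by
  have hnn : ∀ i, ∀ u : ℕ → ℝ, (∀ a, u a ∈ Set.Icc 0 M) →
      0 ≤ M / 2 ^ i * T1^[i] (u 0 / M) ∧ 0 ≤ M / 2 ^ i * T1^[i] (u 1 / M) ∧
      0 ≤ 2 * M / 2 ^ i * T1^[i] ((u 0 + u 1) / (2 * M)) ∧ 0 ≤ aprod M i (u 0) (u 1) := by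
    intro i u hu
    refine ⟨mul_nonneg (by positivity) (T1_iterate_mem (div_mem_unit hM (hu 0)) i).1,
      mul_nonneg (by positivity) (T1_iterate_mem (div_mem_unit hM (hu 1)) i).1,
      mul_nonneg (by positivity) (T1_iterate_mem (add_div_mem_unit hM (hu 0) (hu 1)) i).1,
      aprod_nonneg hM i (hu 0) (hu 1)⟩
  have hT : ∀ a : ℝ, 0 < a → ∀ i t, a / 2 ^ (i + 1) * T1^[i + 1] t =
      a / 2 ^ i * T1^[i] t - 2 * max (a / 2 ^ i * T1^[i] t - a / 2 ^ i / 2) 0 := by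
    intro a ha i t
    rw [← half_mul_T1 (by positivity), Function.iterate_succ_apply', pow_succ, div_div]
  induction i with
  | zero =>
    have h := implements_init hs hk hl hM
    rw [show 2 * l + 3 = 2 * l + 3 + 0 * (6 * l + 11) by ring,
      show 3 * l + 3 = 3 * l + 3 + 0 * (6 * l + 11) by ring] at h
    refine h.congr fun u hu => ?_
    rw [aprod_zero hM.ne']
    simp only [zero_mul, pow_zero, div_one, Function.iterate_zero, id_eq]
    rw [mul_div_cancel₀ _ hM.ne', mul_div_cancel₀ _ hM.ne', mul_div_cancel₀ _ (by positivity)]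
  | succ i ih =>
    have h : i * (2 * l + 4) ≤ i * (6 * l + 11) := Nat.mul_le_mul_left _ (by omega)
    have := ih.iterate hs hk hl (by omega) (M / 2 ^ i / 2) (2 * M / 2 ^ i / 2)
      (-(M / 2 ^ (i + 1))) (M / (4 * 2 ^ (i + 1)) * 2) (fun u hu q => (hu q).1) (hnn i)
      (hnn (i + 1)) (fun u _ => hT M hM i _) (fun u _ => hT M hM i _)
      (fun u _ => hT (2 * M) (by positivity) i _) (fun u _ => aprod_succ M i _ _)
    convert this using 1
    · ring
    · ring
    · ring
    · simp only [show (i + 1) * (2 * l + 4) = i * (2 * l + 4) + (2 * l + 4) by ring]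

theorem stmt13 (s : ℕ) (hs : 2 ≤ s) (U k l : ℕ) (hU : 0 < U) (hk : 0 < k) (hl : 2 ≤ l)
    (M : ℝ) (hM : 0 < M) :
    ∃ (J : ℕ) (ps : List ((Fin (s + 1) → ℝ) × (ℕ → ℝ))),
      ps.length = J ∧
      (J : ℝ) ≤ (128 + 14 * U) * l * k / ((s : ℝ) - 1) + 3 * U + 61 ∧
      ∃ n₁ n₂ : ℕ, n₁ + (l - 1) * k + n₂ = l * k + J * s ∧
        ∀ Y : ℕ → ℕ → ℝ, (∀ a b, Y a b ∈ Set.Icc 0 M) →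
          applyCNN s ps (l * k)
              (fun i => if i < l * k then Y (i / k) (i % k) else 0) =
            fun i =>
              if n₁ ≤ i ∧ i < n₁ + (l - 1) * k then
                if i - n₁ < k then aprod M U (Y 0 (i - n₁)) (Y 1 (i - n₁))
                else Y ((i - n₁) / k + 1) ((i - n₁) % k)
              else 0 := by
  have step := implements_registers hs hk hl hM U
  set β := U * (2 * l + 4) with hβ
  have hm : β ≤ U * (6 * l + 11) := Nat.mul_le_mul_left _ (by omega)
  have hclear := step.step_to hs hk 0 1 (by simp) (fun _ => 0)
    {q | β + 2 ≤ q ∧ q < β + l ∨ q = β + 2 * l + 3} (by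
      rintro q (h | h) <;> omega)
    (G := fun u => tape β l u 0 0 0 (aprod M U (u 0) (u 1))) (by
      intro u hu q
      have h1 := aprod_nonneg hM U (hu 0) (hu 1)
      simp only [Set.mem_ofPred_eq, polyConv_one, add_zero]
      refine ⟨?_, fun h => ?_⟩
      · rintro (h | h)
        · simp only [tape_p h]
          exact max_eq_left (hu _).1
        · simp only [tape_acc h]
          exact max_eq_left h1
      · unfold tape
        split_ifs <;> first | rfl | omega)
  have hshift := hclear.step_to hs hk (2 * l + 2) (1 + Polynomial.X ^ (2 * l + 2))
    (by compute_degree) (fun _ => 0)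
    {q | β + 2 * l + 3 ≤ q ∧ q < β + 2 * l + 3 + (l - 1)} (by
      rintro q ⟨h, h'⟩
      omega)
    (G := fun u q => if β + 2 * l + 3 ≤ q ∧ q < β + 2 * l + 3 + (l - 1) then
      if q = β + 2 * l + 3 then aprod M U (u 0) (u 1) else u (q - (β + 2 * l + 3) + 1) else 0) (by
      intro u hu q
      have h1 := aprod_nonneg hM U (hu 0) (hu 1)
      simp only [Set.mem_ofPred_eq, polyConv_add_left, polyConv_one, polyConv_X_pow, add_zero]
      refine ⟨fun h => ?_, fun h => if_neg h⟩
      rw [if_pos h, if_pos (by omega)]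
      split_ifs with hq
      · rw [tape_acc hq, tape_c (by omega), add_zero, max_eq_left h1]
      · rw [tape_zero hl (by omega), tape_p (by omega), zero_add, max_eq_left (hu _).1]
        congr 1
        omega)
  obtain ⟨-, -, ps, hlen, hsize, hps⟩ := hshift
  refine ⟨ps.length, ps, rfl, ?_, (β + 2 * l + 3) * k,
    l * k + ps.length * s - (β + 2 * l + 3 + (l - 1)) * k, ?_, fun Y hY => ?_⟩
  · have hs1 : (0 : ℝ) < (s : ℝ) - 1 := by
      have : (2 : ℝ) ≤ s := by exact_mod_cast hs
      linarith
    have hD : (((2 * l + 3 + U * (6 * l + 11)) + 0 + (2 * l + 2) : ℕ) : ℝ) ≤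
        (128 + 14 * U) * l := by
      have : (2 * l + 3 + U * (6 * l + 11)) + 0 + (2 * l + 2) ≤ (128 + 14 * U) * l := by
        nlinarith
      exact_mod_cast this
    refine hlen.trans (add_le_add ?_ ?_ |>.trans_eq (add_assoc _ _ _).symm)
    · gcongr
    · push_cast
      linarith
  · have : (β + 2 * l + 3 + (l - 1)) * k ≤ l * k + ps.length * s :=
      (Nat.mul_le_mul_right k (by omega)).trans hsize
    rw [← add_mul]
    omega
  · rw [hps Y hY]
    ext i
    dsimp only
    set n := β + 2 * l + 3 with hn
    have h1 : n ≤ i / k ↔ n * k ≤ i := Nat.le_div_iff_mul_le hk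
    have h2 : i / k < n + (l - 1) ↔ i < n * k + (l - 1) * k := by
      rw [Nat.div_lt_iff_lt_mul hk, add_mul]
    simp only [h1, h2]
    by_cases hi : n * k ≤ i ∧ i < n * k + (l - 1) * k
    · rw [if_pos hi, if_pos hi]
      obtain ⟨r, rfl⟩ := Nat.exists_eq_add_of_le hi.1
      have h3 : (n * k + r) / k = n + r / k := by
        rw [add_comm, Nat.add_mul_div_right _ _ hk, add_comm]
      rw [Nat.add_sub_cancel_left, h3, Nat.mul_add_mod_self_right, Nat.add_sub_cancel_left]
      by_cases hr : r < k
      · rw [if_pos (by rw [Nat.div_eq_of_lt hr, add_zero]), if_pos hr, Nat.mod_eq_of_lt hr]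
      · have h4 : 0 < r / k := Nat.div_pos (by omega) hk
        rw [if_neg (by omega), if_neg hr]
    · rw [if_neg hi, if_neg hi]
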